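/- Let d be a positive integer, n ≥ 2, and let (X_j, Y_j, Δ_j), j = 1, …, n, be survival data with X_j ∈ ℝᵈ, Y_j ∈ ℝ, Δ_j ∈ {0,1}, where the observed times Y₁, …, Yₙ are pairwise distinct. Fix i ∈ {1,…,n}. Then for every θ ∈ ℝᵈ, the difference of gradients between the full-data and leave-one-out Cox negative log partial likelihoods satisfies ∇_θ𝓛_n(θ) − ∇_θ𝓛_{n−1}^{(-i)}(θ) = −Δ_i·( X_i − S_n^{(1)}(Y_i; θ)/S_n^{(0)}(Y_i; θ) ) + exp(⟨θ, X_i⟩)·(1/n)·Σ_{j=1}^n 1[Y_j < Y_i]·Δ_j / ( S_n^{(0)}(Y_j; θ) − exp(⟨θ, X_i⟩)/n ) · ( X_i − S_n^{(1)}(Y_j; θ)/S_n^{(0)}(Y_j; θ) ), where all denominators appearing are positive since the corresponding risk sets with index i removed still contain the index j of each summand. -/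

import Mathlib

open RealInnerProductSpace

theorem cox_aux_pos {d n : ℕ} (X : Fin n → EuclideanSpace ℝ (Fin d)) (s : Finset (Fin n))
    (Y : Fin n → ℝ) (θ : EuclideanSpace ℝ (Fin d)) (j : Fin n) (hj : j ∈ s) :
    0 < ∑ k ∈ s, (if Y j ≤ Y k then Real.exp ⟪θ, X k⟫ else 0) := by
  refine Finset.sum_pos' (fun k _ => ?_) ⟨j, hj, ?_⟩
  · split_ifs <;> positivity
  · simp [Real.exp_pos]

theorem cox_aux_log {d n : ℕ} (X : Fin n → EuclideanSpace ℝ (Fin d)) (s : Finset (Fin n))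
    (p : Fin n → Prop) [DecidablePred p] (θ : EuclideanSpace ℝ (Fin d))
    (h : (∑ k ∈ s, (if p k then Real.exp ⟪θ, X k⟫ else 0)) ≠ 0) :
    HasFDerivAt (fun θ : EuclideanSpace ℝ (Fin d) =>
      Real.log (∑ k ∈ s, (if p k then Real.exp ⟪θ, X k⟫ else 0)))
      (InnerProductSpace.toDual ℝ (EuclideanSpace ℝ (Fin d))
        ((∑ k ∈ s, (if p k then Real.exp ⟪θ, X k⟫ else 0))⁻¹ •
          ∑ k ∈ s, (if p k then Real.exp ⟪θ, X k⟫ • X k else 0))) θ := by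
  have h1 : ∀ k, HasFDerivAt (fun θ : EuclideanSpace ℝ (Fin d) => ⟪θ, X k⟫)
      (InnerProductSpace.toDual ℝ (EuclideanSpace ℝ (Fin d)) (X k)) θ := by
    intro k
    have := (InnerProductSpace.toDual ℝ (EuclideanSpace ℝ (Fin d)) (X k)).hasFDerivAt (x := θ)
    refine this.congr_of_eventuallyEq (Filter.Eventually.of_forall fun x => ?_)
    simp [InnerProductSpace.toDual_apply_apply, real_inner_comm]
  have h2 : HasFDerivAt (fun θ : EuclideanSpace ℝ (Fin d) =>
      ∑ k ∈ s, (if p k then Real.exp ⟪θ, X k⟫ else 0))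
      (∑ k ∈ s, InnerProductSpace.toDual ℝ (EuclideanSpace ℝ (Fin d))
        (if p k then Real.exp ⟪θ, X k⟫ • X k else 0)) θ := by
    refine HasFDerivAt.fun_sum fun k _ => ?_
    by_cases hp : p k
    · simp only [hp, if_true, map_smul]
      simpa using (h1 k).exp
    · simp only [hp, if_false, map_zero]
      exact hasFDerivAt_const _ _
  have h3 := h2.log h
  rw [← map_sum] at h3
  simpa using h3

theorem cox_aux_grad {d n : ℕ} (X : Fin n → EuclideanSpace ℝ (Fin d)) (s t : Finset (Fin n))
    (Y : Fin n → ℝ) (θ : EuclideanSpace ℝ (Fin d)) (hts : t ⊆ s)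
    (L : EuclideanSpace ℝ (Fin d) → ℝ)
    (hL : ∀ θ, L θ = -∑ j ∈ t, (⟪θ, X j⟫ - Real.log
          (∑ k ∈ s, (if Y j ≤ Y k then Real.exp ⟪θ, X k⟫ else 0)))) :
    gradient L θ = -∑ j ∈ t, (X j - (∑ k ∈ s, (if Y j ≤ Y k then Real.exp ⟪θ, X k⟫ else 0))⁻¹ •
          ∑ k ∈ s, (if Y j ≤ Y k then Real.exp ⟪θ, X k⟫ • X k else 0)) := by
  apply HasGradientAt.gradient
  rw [hasGradientAt_iff_hasFDerivAt, funext hL, map_neg, map_sum]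
  refine HasFDerivAt.fun_neg (HasFDerivAt.fun_sum fun j hj => ?_)
  rw [map_sub]
  refine HasFDerivAt.fun_sub ?_ (cox_aux_log X s (fun k => Y j ≤ Y k) θ ?_)
  · have := (InnerProductSpace.toDual ℝ (EuclideanSpace ℝ (Fin d)) (X j)).hasFDerivAt (x := θ)
    refine this.congr_of_eventuallyEq (Filter.Eventually.of_forall fun x => ?_)
    simp [InnerProductSpace.toDual_apply_apply, real_inner_comm]
  · exact (cox_aux_pos X s Y θ j (hts hj)).ne'

/-- With pairwise distinct observed times, the difference of gradients between
the full-data and leave-one-out Cox negative log partial likelihoods satisfies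
`∇𝓛_n(θ) − ∇𝓛_{n−1}^{(-i)}(θ) = −Δ i • (X i − S₁(Y i; θ)/S₀(Y i; θ))
  + e^{⟪θ,X i⟫} • (1/n) • ∑_{j : Y j < Y i, Δ j = 1}
      (S₀(Y j; θ) − e^{⟪θ,X i⟫}/n)⁻¹ • (X i − S₁(Y j; θ)/S₀(Y j; θ))`. -/
theorem cox_gradient_difference
    (d n : ℕ) (hd : 0 < d) (hn : 2 ≤ n)
    (X : Fin n → EuclideanSpace ℝ (Fin d)) (Y : Fin n → ℝ) (Δ : Fin n → Bool)
    (hY : Function.Injective Y) (i : Fin n)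
    (S0 : ℝ → EuclideanSpace ℝ (Fin d) → ℝ)
    (hS0 : ∀ t θ, S0 t θ =
      (n : ℝ)⁻¹ * ∑ j : Fin n, (if t ≤ Y j then Real.exp ⟪θ, X j⟫ else 0))
    (S1 : ℝ → EuclideanSpace ℝ (Fin d) → EuclideanSpace ℝ (Fin d))
    (hS1 : ∀ t θ, S1 t θ =
      (n : ℝ)⁻¹ • ∑ j : Fin n, (if t ≤ Y j then Real.exp ⟪θ, X j⟫ • X j else 0))
    (L : EuclideanSpace ℝ (Fin d) → ℝ)
    (hL : ∀ θ, L θ =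
      -∑ j ∈ Finset.univ.filter (fun j => Δ j = true),
        (⟪θ, X j⟫ - Real.log
          (∑ k : Fin n, (if Y j ≤ Y k then Real.exp ⟪θ, X k⟫ else 0))))
    (Li : EuclideanSpace ℝ (Fin d) → ℝ)
    (hLi : ∀ θ, Li θ =
      -∑ j ∈ Finset.univ.filter (fun j => j ≠ i ∧ Δ j = true),
        (⟪θ, X j⟫ - Real.log
          (∑ k ∈ Finset.univ.filter (fun k => k ≠ i),
            (if Y j ≤ Y k then Real.exp ⟪θ, X k⟫ else 0)))) :
    ∀ θ, gradient L θ - gradient Li θ =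
      -((if Δ i = true then (1 : ℝ) else 0) • (X i - (S0 (Y i) θ)⁻¹ • S1 (Y i) θ))
      + Real.exp ⟪θ, X i⟫ •
          ((n : ℝ)⁻¹ • ∑ j ∈ Finset.univ.filter (fun j => Y j < Y i ∧ Δ j = true),
            (S0 (Y j) θ - Real.exp ⟪θ, X i⟫ / n)⁻¹ •
              (X i - (S0 (Y j) θ)⁻¹ • S1 (Y j) θ)) := by
  intro θ
  have hn0 : (n : ℝ) ≠ 0 := by
    have : n ≠ 0 := by omega
    exact_mod_cast this
  simp only [Finset.smul_sum]
  rw [cox_aux_grad X Finset.univ _ Y θ (Finset.subset_univ _) L hL,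
    cox_aux_grad X (Finset.univ.filter (fun k => k ≠ i)) _ Y θ
      (by intro j; simp; tauto) Li hLi]
  have hi : ∀ v : EuclideanSpace ℝ (Fin d), v = ∑ j : Fin n, if j = i then v else 0 := by
    intro v; simp
  rw [hi (-((if Δ i = true then (1 : ℝ) else 0) • (X i - (S0 (Y i) θ)⁻¹ • S1 (Y i) θ)))]
  rw [Finset.sum_filter, Finset.sum_filter (fun j => j ≠ i ∧ Δ j = true),
    Finset.sum_filter (fun j => Y j < Y i ∧ Δ j = true), ← Finset.sum_neg_distrib,
    ← Finset.sum_neg_distrib, ← Finset.sum_sub_distrib, ← Finset.sum_add_distrib]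
  refine Finset.sum_congr rfl fun j _ => ?_
  have hA := cox_aux_pos X Finset.univ Y θ j (Finset.mem_univ j)
  have hA' : j ≠ i → _ := fun h => cox_aux_pos X (Finset.univ.filter (fun k => k ≠ i)) Y θ j
    (by simp [h])
  have eA : (∑ k ∈ Finset.univ.filter (fun k => k ≠ i),
      (if Y j ≤ Y k then Real.exp ⟪θ, X k⟫ else 0)) =
      (∑ k, (if Y j ≤ Y k then Real.exp ⟪θ, X k⟫ else 0)) -
        (if Y j ≤ Y i then Real.exp ⟪θ, X i⟫ else 0) := by
    rw [Finset.filter_ne', ← Finset.sum_erase_add _ _ (Finset.mem_univ i), add_sub_cancel_right]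
  have eB : (∑ k ∈ Finset.univ.filter (fun k => k ≠ i),
      (if Y j ≤ Y k then Real.exp ⟪θ, X k⟫ • X k else 0)) =
      (∑ k, (if Y j ≤ Y k then Real.exp ⟪θ, X k⟫ • X k else 0)) -
        (if Y j ≤ Y i then Real.exp ⟪θ, X i⟫ • X i else 0) := by
    rw [Finset.filter_ne', ← Finset.sum_erase_add _ _ (Finset.mem_univ i), add_sub_cancel_right]
  rw [eA] at hA'
  rw [eA, eB]
  have hS : (S0 (Y j) θ)⁻¹ • S1 (Y j) θ =
      (∑ k, (if Y j ≤ Y k then Real.exp ⟪θ, X k⟫ else 0))⁻¹ •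
      (∑ k, (if Y j ≤ Y k then Real.exp ⟪θ, X k⟫ • X k else 0)) := by
    rw [hS0, hS1, smul_smul]
    congr 1
    field_simp
  by_cases hji : j = i
  · subst hji
    by_cases hD : Δ j = true
    · simp [hD, hS]
    · simp [hD]
  by_cases hD : Δ j = true
  swap
  · simp [hD, hji]
  rw [hS, hS0 (Y j) θ]
  generalize (∑ k, (if Y j ≤ Y k then Real.exp ⟪θ, X k⟫ else 0)) = A at *
  generalize (∑ k, (if Y j ≤ Y k then Real.exp ⟪θ, X k⟫ • X k else 0)) = B at *
  have hA'' := hA' hji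
  by_cases hlt : Y j < Y i
  · simp only [hlt, hlt.le, hji, hD, if_true, if_false, ne_eq, not_false_eq_true, and_self,
      zero_add] at hA'' ⊢
    generalize Real.exp ⟪θ, X i⟫ = e at *
    have hA0 := hA.ne'
    have hA1 := hA''.ne'
    have e1 : (n : ℝ)⁻¹ * A - e / n = (n : ℝ)⁻¹ * (A - e) := by field_simp
    rw [e1]
    ext m
    simp
    field_simp
    ring
  · have hle : ¬ Y j ≤ Y i := fun h => hlt (lt_of_le_of_ne h fun h' => hji (hY h'))
    simp [hlt, hle, hji, hD]
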